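/- arXiv:2304.06646 — 10 statements merged into one kernel-verified Lean document; each statement's English description precedes it below -/
import Mathlib

section
/- For every finite set Prop, no modal formula has a finite characterisation with respect to the full modal language: for every φ ∈ L_full[Prop] and every pair (E⁺,E⁻) of finite sets of finite pointed models such that φ is true at every member of E⁺ and false at every member of E⁻, there exists ψ ∈ L_full[Prop] not equivalent to φ that is also true at every member of E⁺ and false at every member of E⁻. -/
/-- Modal formulas over propositional variables `α`, in negation normal form. -/
inductive MF (α : Type) : Type
  | top : MF α
  | bot : MF α
  | var : α → MF α
  | nvar : α → MF α
  | and : MF α → MF α → MF α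
  | or : MF α → MF α → MF α
  | dia : MF α → MF α
  | box : MF α → MF α

/-- A pointed Kripke model over propositional variables `α`. -/
structure PModel (α : Type) where
  World : Type
  Rel : World → World → Prop
  val : World → Set α
  pt : World

/-- Satisfaction of a modal formula at a world of a Kripke model. -/
def Sat {α : Type} (M : PModel α) : M.World → MF α → Prop
  | _, MF.top => True
  | _, MF.bot => False
  | w, MF.var p => p ∈ M.val w
  | w, MF.nvar p => p ∉ M.val w
  | w, MF.and φ ψ => Sat M w φ ∧ Sat M w ψ
  | w, MF.or φ ψ => Sat M w φ ∨ Sat M w ψ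
  | w, MF.dia φ => ∃ u, M.Rel w u ∧ Sat M u φ
  | w, MF.box φ => ∀ u, M.Rel w u → Sat M u φ

/-- Satisfaction at the distinguished point of a pointed model. -/
def PSat {α : Type} (M : PModel α) (φ : MF α) : Prop := Sat M M.pt φ

/-- Logical equivalence: satisfied by exactly the same pointed models. -/
def MFEquiv {α : Type} (φ ψ : MF α) : Prop := ∀ M : PModel α, PSat M φ ↔ PSat M ψ
/-- `MF.dia^[n] MF.top` says that a path of length `n` starts here; `MF.box^[n] MF.bot` denies it. -/
theorem sat_iterate_box_bot {α : Type} (M : PModel α) (n : ℕ) (w : M.World) :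
    Sat M w (MF.box^[n] MF.bot) ↔ ¬ Sat M w (MF.dia^[n] MF.top) := by
  induction n generalizing w with
  | zero => simp [Sat]
  | succ n ih => simp [Function.iterate_succ_apply', Sat, ih]

theorem sat_iterate_dia_top_of_le {α : Type} (M : PModel α) {m n : ℕ} (hmn : m ≤ n)
    (w : M.World) (h : Sat M w (MF.dia^[n] MF.top)) : Sat M w (MF.dia^[m] MF.top) := by
  induction m generalizing n w with
  | zero => trivial
  | succ m ih =>
    obtain ⟨n, rfl⟩ : ∃ k, n = k + 1 := ⟨n - 1, by omega⟩
    rw [Function.iterate_succ_apply'] at h ⊢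
    obtain ⟨u, hu, hsat⟩ := h
    exact ⟨u, hu, ih (by omega) u hsat⟩

/-- The formula saying that the longest path from the current world has length exactly `n`. -/
def heightEq (α : Type) (n : ℕ) : MF α :=
  MF.and (MF.dia^[n] MF.top) (MF.box^[n + 1] MF.bot)

/-- The negation normal form of the negation of `heightEq α n`. -/
def heightNe (α : Type) (n : ℕ) : MF α :=
  MF.or (MF.box^[n] MF.bot) (MF.dia^[n + 1] MF.top)

theorem psat_heightEq {α : Type} (M : PModel α) (n : ℕ) :
    PSat M (heightEq α n) ↔
      Sat M M.pt (MF.dia^[n] MF.top) ∧ ¬ Sat M M.pt (MF.dia^[n + 1] MF.top) := by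
  rw [← sat_iterate_box_bot]
  rfl

theorem psat_heightNe {α : Type} (M : PModel α) (n : ℕ) :
    PSat M (heightNe α n) ↔ ¬ PSat M (heightEq α n) := by
  rw [psat_heightEq, not_and_or, not_not, ← sat_iterate_box_bot]
  rfl

theorem eq_of_psat_heightEq {α : Type} (M : PModel α) {m n : ℕ}
    (hm : PSat M (heightEq α m)) (hn : PSat M (heightEq α n)) : m = n := by
  rw [psat_heightEq] at hm hn
  rcases lt_trichotomy m n with h | h | h
  · exact absurd (sat_iterate_dia_top_of_le M h _ hn.1) hm.2
  · exact h
  · exact absurd (sat_iterate_dia_top_of_le M h _ hm.1) hn.2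

/-- The descending chain on the natural numbers, pointed at `n`. -/
def chain (α : Type) (n : ℕ) : PModel α where
  World := ℕ
  Rel i j := i = j + 1
  val _ := ∅
  pt := n

theorem sat_chain_iterate_dia_top (α : Type) (n k : ℕ) (w : ℕ) :
    Sat (chain α n) w (MF.dia^[k] MF.top) ↔ k ≤ w := by
  induction k generalizing w with
  | zero => simp [Sat]
  | succ k ih =>
    rw [Function.iterate_succ_apply']
    constructor
    · rintro ⟨u, hu, hsat⟩
      obtain rfl : w = Nat.succ u := hu
      exact Nat.succ_le_succ ((ih u).1 hsat)
    · intro h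
      exact ⟨w - 1, (by omega : w = w - 1 + 1), (ih (w - 1)).2 (by omega)⟩

theorem psat_chain_heightEq (α : Type) (n : ℕ) : PSat (chain α n) (heightEq α n) :=
  (psat_heightEq _ n).2
    ⟨(sat_chain_iterate_dia_top α n n n).2 le_rfl,
      fun h => absurd ((sat_chain_iterate_dia_top α n (n + 1) n).1 h) (by omega)⟩

theorem exists_forall_not_psat_heightEq {α : Type} {E : Set (PModel α)} (hE : E.Finite) :
    ∃ n, ∀ M ∈ E, ¬ PSat M (heightEq α n) := by
  by_contra! h
  choose f hfE hf using h
  refine Set.infinite_of_injective_forall_mem (f := f) (fun m n hmn => ?_) hfE hE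
  exact eq_of_psat_heightEq (f n) (hmn ▸ hf m) (hf n)

/-- no modal formula has a finite characterisation with respect to
the full modal language: for every formula `φ` and every pair `(E⁺,E⁻)` of finite
sets of finite pointed models that `φ` fits, there is a non-equivalent formula `ψ`
that also fits `(E⁺,E⁻)`. -/
theorem no_finite_characterisation_full {α : Type} [Fintype α] (φ : MF α)
    (Ep En : Set (PModel α)) (hEp : Ep.Finite) (hEn : En.Finite)
    (hEpFin : ∀ M ∈ Ep, Finite M.World) (hEnFin : ∀ M ∈ En, Finite M.World)
    (hpos : ∀ M ∈ Ep, PSat M φ) (hneg : ∀ M ∈ En, ¬ PSat M φ) :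
    ∃ ψ : MF α, ¬ MFEquiv ψ φ ∧ (∀ M ∈ Ep, PSat M ψ) ∧ (∀ M ∈ En, ¬ PSat M ψ) := by
  obtain ⟨n, hn⟩ := exists_forall_not_psat_heightEq (hEp.union hEn)
  have hchain := psat_chain_heightEq α n
  by_cases hφ : PSat (chain α n) φ
  · refine ⟨MF.and φ (heightNe α n), fun h => ?_, fun M hM => ⟨hpos M hM, ?_⟩,
      fun M hM h => hneg M hM h.1⟩
    · exact (psat_heightNe _ n).1 ((h (chain α n)).2 hφ).2 hchain
    · exact (psat_heightNe M n).2 (hn M (Or.inl hM))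
  · refine ⟨MF.or φ (heightEq α n), fun h => ?_, fun M hM => Or.inl (hpos M hM),
      fun M hM h => ?_⟩
    · exact hφ ((h (chain α n)).1 (Or.inr hchain))
    · exact h.elim (hneg M hM) (hn M (Or.inr hM))
end

section
/- Let F be a class of Kripke frames and Prop a finite set. The full modal language L_full[Prop] admits finite characterisations with respect to F (i.e., every φ ∈ L_full[Prop] has a finite characterisation whose examples are pointed models based on frames in F) if and only if the set {mod_F(φ) : φ ∈ L_full[Prop]} is finite, i.e., there are only finitely many modal formulas over Prop up to equivalence over F. -/
/-- A Kripke frame: a set of worlds with a binary accessibility relation. -/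
structure KFrame where
  World : Type
  Rel : World → World → Prop

/-- The underlying frame of a pointed model. -/
def PModel.frame {α : Type} (M : PModel α) : KFrame := ⟨M.World, M.Rel⟩

/-- A pointed model is based on the frame class `F` if its underlying frame belongs to `F`. -/
def BasedOn {α : Type} (F : Set KFrame) (M : PModel α) : Prop := M.frame ∈ F

/-- `mod_F(φ)`: the pointed models based on `F` satisfying `φ`. -/
def modF {α : Type} (F : Set KFrame) (φ : MF α) : Set (PModel α) :=
  {M | BasedOn F M ∧ PSat M φ}

/-- The negation normal form of the negation of a modal formula. -/
def MF.neg {α : Type} : MF α → MF α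
  | MF.top => MF.bot
  | MF.bot => MF.top
  | MF.var p => MF.nvar p
  | MF.nvar p => MF.var p
  | MF.and φ ψ => MF.or φ.neg ψ.neg
  | MF.or φ ψ => MF.and φ.neg ψ.neg
  | MF.dia φ => MF.box φ.neg
  | MF.box φ => MF.dia φ.neg

theorem sat_neg {α : Type} (M : PModel α) (φ : MF α) (w : M.World) :
    Sat M w φ.neg ↔ ¬ Sat M w φ := by
  induction φ generalizing w with
  | and φ ψ hφ hψ => simp only [MF.neg, Sat, hφ, hψ]; tauto
  | or φ ψ hφ hψ => simp only [MF.neg, Sat, hφ, hψ]; tauto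
  | dia φ hφ => simp [MF.neg, Sat, hφ]
  | box φ hφ => simp [MF.neg, Sat, hφ]
  | _ => simp [MF.neg, Sat]

/-- The biconditional of two modal formulas. -/
def MF.iff {α : Type} (φ ψ : MF α) : MF α :=
  MF.or (MF.and φ ψ) (MF.and φ.neg ψ.neg)

theorem psat_iff {α : Type} (M : PModel α) (φ ψ : MF α) :
    PSat M (φ.iff ψ) ↔ (PSat M φ ↔ PSat M ψ) := by
  simp only [PSat, MF.iff, Sat, sat_neg]
  tauto

/-- If validity over `F` is detected by finitely many pointed models, then there are only
finitely many formulas up to equivalence over `F`. -/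
theorem finite_range_modF_of_detects_valid {α : Type} {F : Set KFrame} {E : Set (PModel α)}
    (hfin : E.Finite) (hbased : ∀ M ∈ E, BasedOn F M)
    (hE : ∀ ψ : MF α, (∀ M ∈ E, PSat M ψ) → ∀ M, BasedOn F M → PSat M ψ) :
    (Set.range (modF F : MF α → Set (PModel α))).Finite := by
  refine Set.Finite.of_finite_image (f := fun S => S ∩ E)
    (hfin.powerset.subset ?_) ?_
  · rintro _ ⟨S, -, rfl⟩
    exact Set.inter_subset_right
  · rintro _ ⟨φ, rfl⟩ _ ⟨ψ, rfl⟩ h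
    have hiff := hE (φ.iff ψ) fun M hM => (psat_iff M φ ψ).2 <| by
      have := Set.ext_iff.1 h M
      simpa [modF, hM, hbased M hM] using this
    ext M
    exact and_congr_right fun hM => (psat_iff M φ ψ).1 (hiff M hM)

/-- Finitely many sets can be tested for emptiness on a finite subset of their union. -/
theorem exists_finite_hitting_set {β : Type*} {𝒞 : Set (Set β)} (h𝒞 : 𝒞.Finite) :
    ∃ E : Set β, E.Finite ∧ (∀ x ∈ E, ∃ S ∈ 𝒞, x ∈ S) ∧
      ∀ S ∈ 𝒞, S.Nonempty → (S ∩ E).Nonempty := by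
  classical
  refine ⟨⋃ S ∈ 𝒞, if h : S.Nonempty then {h.some} else ∅,
    h𝒞.biUnion fun S _ => ?_, fun x hx => ?_, fun S hS h => ⟨h.some, h.some_mem, ?_⟩⟩
  · split_ifs <;> simp
  · obtain ⟨S, hS, hx⟩ := Set.mem_iUnion₂.1 hx
    split_ifs at hx with h
    · exact ⟨S, hS, hx ▸ h.some_mem⟩
    · exact hx.elim
  · exact Set.mem_iUnion₂.2 ⟨S, hS, by simp [h]⟩

/-- the full modal language admits finite characterisations with
respect to a frame class `F` iff there are only finitely many modal formulas up
to equivalence over `F`, i.e. `{mod_F(φ) : φ}` is finite. -/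
theorem full_admits_finChar_iff_essentially_finite (α : Type) [Fintype α] (F : Set KFrame) :
    (∀ φ : MF α, ∃ Ep En : Set (PModel α),
        Ep.Finite ∧ En.Finite ∧
        (∀ M ∈ Ep, BasedOn F M) ∧ (∀ M ∈ En, BasedOn F M) ∧
        (∀ M ∈ Ep, PSat M φ) ∧ (∀ M ∈ En, ¬ PSat M φ) ∧
        (∀ ψ : MF α, (∀ M ∈ Ep, PSat M ψ) → (∀ M ∈ En, ¬ PSat M ψ) →
          modF F ψ = modF F φ))
    ↔ (Set.range (modF F : MF α → Set (PModel α))).Finite := by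
  constructor
  · intro h
    obtain ⟨Ep, En, hEp, -, hbased, -, -, hEn, hchar⟩ := h MF.top
    refine finite_range_modF_of_detects_valid hEp hbased fun ψ hψ M hM => ?_
    have hmod := hchar ψ hψ fun N hN => (hEn N hN trivial).elim
    have hmem : M ∈ modF F MF.top := ⟨hM, trivial⟩
    exact (hmod ▸ hmem).2
  · intro h φ
    obtain ⟨Ep, hEp, hEp_mem, hEp_hit⟩ :=
      exists_finite_hitting_set (h.image fun S => modF F φ \ S)
    obtain ⟨En, hEn, hEn_mem, hEn_hit⟩ :=
      exists_finite_hitting_set (h.image fun S => S \ modF F φ)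
    have hp : ∀ M ∈ Ep, M ∈ modF F φ := by
      intro M hM
      obtain ⟨_, ⟨S, -, rfl⟩, hMS⟩ := hEp_mem M hM
      exact hMS.1
    have hn : ∀ M ∈ En, BasedOn F M ∧ ¬ PSat M φ := by
      intro M hM
      obtain ⟨_, ⟨_, ⟨χ, rfl⟩, rfl⟩, hMχ, hMφ⟩ := hEn_mem M hM
      exact ⟨hMχ.1, fun hs => hMφ ⟨hMχ.1, hs⟩⟩
    refine ⟨Ep, En, hEp, hEn, fun M hM => (hp M hM).1, fun M hM => (hn M hM).1,
      fun M hM => (hp M hM).2, fun M hM => (hn M hM).2, fun ψ hψp hψn => ?_⟩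
    apply Set.Subset.antisymm
    · rw [← Set.sdiff_eq_empty, ← Set.not_nonempty_iff_eq_empty]
      intro hne
      obtain ⟨M, ⟨hMψ, -⟩, hM⟩ := hEn_hit _ ⟨_, ⟨ψ, rfl⟩, rfl⟩ hne
      exact hψn M hM hMψ.2
    · rw [← Set.sdiff_eq_empty, ← Set.not_nonempty_iff_eq_empty]
      intro hne
      obtain ⟨M, ⟨hMφ, hMψ⟩, hM⟩ := hEp_hit _ ⟨_, ⟨ψ, rfl⟩, rfl⟩ hne
      exact hMψ ⟨hMφ.1, hψp M hM⟩
end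

section
/- For every finite set Prop, the fragment L_{□,◇,∧,∨}[Prop] admits finite characterisations: every formula φ built from propositional variables using only ∧, ∨, ◇, □ has a finite characterisation (E⁺,E⁻) consisting of finite pointed models such that every ψ ∈ L_{□,◇,∧,∨}[Prop] true at all members of E⁺ and false at all members of E⁻ is equivalent to φ. -/
/-- The fragment L_{□,◇,∧,∨}: formulas built from propositional variables using
only the connectives ∧, ∨, ◇, □ (no ⊤, ⊥, negation). -/
inductive PosForm {α : Type} : MF α → Prop
  | var (p : α) : PosForm (MF.var p)
  | and {φ ψ : MF α} : PosForm φ → PosForm ψ → PosForm (MF.and φ ψ)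
  | or {φ ψ : MF α} : PosForm φ → PosForm ψ → PosForm (MF.or φ ψ)
  | dia {φ : MF α} : PosForm φ → PosForm (MF.dia φ)
  | box {φ : MF α} : PosForm φ → PosForm (MF.box φ)
/-- `(Ep, En)` is a finite characterisation of `φ` with respect to the set `L` of
modal formulas: both are finite sets of finite pointed models, `φ` is true at every
member of `Ep` and false at every member of `En`, and every `ψ ∈ L` with this
property is equivalent to `φ`. -/
def FinCharOf {α : Type} (L : Set (MF α)) (φ : MF α) (Ep En : Set (PModel α)) : Prop :=
  Ep.Finite ∧ En.Finite ∧
  (∀ M ∈ Ep, Finite M.World) ∧ (∀ M ∈ En, Finite M.World) ∧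
  (∀ M ∈ Ep, PSat M φ) ∧ (∀ M ∈ En, ¬ PSat M φ) ∧
  (∀ ψ ∈ L, (∀ M ∈ Ep, PSat M ψ) → (∀ M ∈ En, ¬ PSat M ψ) → MFEquiv ψ φ)

/-- Trees of height at most `n` with nodes coloured by sets of variables, in which distinct
children of a node carry distinct subtrees. A tree of height `0` is a bare leaf. -/
def ColTree (α : Type) : ℕ → Type
  | 0 => Unit
  | n + 1 => Set α × Set (ColTree α n)

namespace ColTree

variable {α : Type}

instance instFinite [Finite α] : ∀ n, Finite (ColTree α n)
  | 0 => inferInstanceAs (Finite Unit)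
  | n + 1 =>
    have := instFinite n
    inferInstanceAs (Finite (Set α × Set (ColTree α n)))

/-- The colour of the root of a tree, where leaves have colour `c`. -/
def color (c : Set α) : (Σ n, ColTree α n) → Set α
  | ⟨0, _⟩ => c
  | ⟨_ + 1, t⟩ => t.1

/-- The accessibility relation between trees: a tree sees its children, and the leaf sees itself. -/
def Child : (Σ n, ColTree α n) → (Σ n, ColTree α n) → Prop
  | ⟨0, t⟩, y => y = ⟨0, t⟩
  | ⟨n + 1, t⟩, y => ∃ s ∈ t.2, y = ⟨n, s⟩

/-- The pointed model whose worlds are the trees of height at most `n`, pointed at `t`, in which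
the leaf is a reflexive world of colour `c`. -/
def model (c : Set α) {n : ℕ} (t : ColTree α n) : PModel α where
  World := {x : Σ k, ColTree α k // x.1 ≤ n}
  Rel x y := Child x.1 y.1
  val x := color c x.1
  pt := ⟨⟨n, t⟩, le_rfl⟩

theorem finite_world_model [Finite α] (c : Set α) {n : ℕ} (t : ColTree α n) :
    Finite (model c t).World :=
  Finite.of_injective
    (fun x : {x : Σ k, ColTree α k // x.1 ≤ n} =>
      (⟨⟨x.1.1, Nat.lt_succ_of_le x.2⟩, x.1.2⟩ : Σ k : Fin (n + 1), ColTree α k))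
    (by
      rintro ⟨⟨i, a⟩, hi⟩ ⟨⟨j, b⟩, hj⟩ h
      simp only [Sigma.mk.injEq, Fin.mk.injEq] at h
      obtain ⟨rfl, h⟩ := h
      cases h
      rfl)

/-- The tree of height `n` obtained by unravelling a Kripke model from a world. -/
def unravel (M : PModel α) : (n : ℕ) → M.World → ColTree α n
  | 0, _ => ()
  | n + 1, w => (M.val w, {t | ∃ u, M.Rel w u ∧ unravel M n u = t})

variable {n k : ℕ} {c : Set α} {t : ColTree α n}

theorem rel_leaf_iff {s : ColTree α 0} {h : 0 ≤ n} {y : (model c t).World} :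
    (model c t).Rel ⟨⟨0, s⟩, h⟩ y ↔ y = ⟨⟨0, s⟩, h⟩ :=
  ⟨fun hy => Subtype.ext hy, fun hy => congrArg Subtype.val hy⟩

theorem rel_unravel_iff {M : PModel α} {w : M.World} {h : k + 1 ≤ n} {y : (model c t).World} :
    (model c t).Rel ⟨⟨k + 1, unravel M (k + 1) w⟩, h⟩ y ↔
      ∃ u, M.Rel w u ∧ y = ⟨⟨k, unravel M k u⟩, (Nat.le_succ k).trans h⟩ := by
  constructor
  · rintro ⟨_, ⟨u, hu, rfl⟩, hy⟩
    exact ⟨u, hu, Subtype.ext hy⟩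
  · rintro ⟨u, hu, rfl⟩
    exact ⟨_, ⟨u, hu, rfl⟩, rfl⟩

theorem not_sat_leaf_empty {s : ColTree α 0} {h : 0 ≤ n} {ψ : MF α} (hψ : PosForm ψ) :
    ¬ Sat (model ∅ t) ⟨⟨0, s⟩, h⟩ ψ := by
  induction hψ with
  | var p => exact fun hp => hp
  | and _ _ ih _ => exact fun hs => ih hs.1
  | or _ _ ih₁ ih₂ => exact fun hs => hs.elim ih₁ ih₂
  | dia _ ih =>
    rintro ⟨u, hu, hs⟩
    rw [rel_leaf_iff.1 hu] at hs
    exact ih hs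
  | box _ ih => exact fun hs => ih (hs _ (rel_leaf_iff.2 rfl))

theorem sat_leaf_univ {s : ColTree α 0} {h : 0 ≤ n} {ψ : MF α} (hψ : PosForm ψ) :
    Sat (model Set.univ t) ⟨⟨0, s⟩, h⟩ ψ := by
  induction hψ with
  | var p => exact Set.mem_univ p
  | and _ _ ih₁ ih₂ => exact ⟨ih₁, ih₂⟩
  | or _ _ ih _ => exact Or.inl ih
  | dia _ ih => exact ⟨_, rel_leaf_iff.2 rfl, ih⟩
  | box _ ih =>
    intro u hu
    rw [rel_leaf_iff.1 hu]
    exact ih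

theorem sat_of_sat_unravel_empty {M : PModel α} {ψ : MF α} (hψ : PosForm ψ) {h : k ≤ n}
    {w : M.World} (hs : Sat (model ∅ t) ⟨⟨k, unravel M k w⟩, h⟩ ψ) : Sat M w ψ := by
  induction hψ generalizing k w with
  | var p =>
    cases k with
    | zero => exact (not_sat_leaf_empty (.var p) hs).elim
    | succ k => exact hs
  | and _ _ ih₁ ih₂ => exact ⟨ih₁ hs.1, ih₂ hs.2⟩
  | or _ _ ih₁ ih₂ => exact hs.imp ih₁ ih₂
  | dia hψ ih =>
    cases k with
    | zero => exact (not_sat_leaf_empty (.dia hψ) hs).elim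
    | succ k =>
      obtain ⟨y, hy, hs⟩ := hs
      obtain ⟨u, hu, rfl⟩ := rel_unravel_iff.1 hy
      exact ⟨u, hu, ih hs⟩
  | box hψ ih =>
    cases k with
    | zero => exact (not_sat_leaf_empty (.box hψ) hs).elim
    | succ k => exact fun u hu => ih (hs _ (rel_unravel_iff.2 ⟨u, hu, rfl⟩))

theorem sat_unravel_univ_of_sat {M : PModel α} {ψ : MF α} (hψ : PosForm ψ) {h : k ≤ n}
    {w : M.World} (hs : Sat M w ψ) : Sat (model Set.univ t) ⟨⟨k, unravel M k w⟩, h⟩ ψ := by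
  induction hψ generalizing k w with
  | var p =>
    cases k with
    | zero => exact sat_leaf_univ (.var p)
    | succ k => exact hs
  | and _ _ ih₁ ih₂ => exact ⟨ih₁ hs.1, ih₂ hs.2⟩
  | or _ _ ih₁ ih₂ => exact hs.imp ih₁ ih₂
  | dia hψ ih =>
    cases k with
    | zero => exact sat_leaf_univ (.dia hψ)
    | succ k =>
      obtain ⟨u, hu, hs⟩ := hs
      exact ⟨_, rel_unravel_iff.2 ⟨u, hu, rfl⟩, ih hs⟩
  | box hψ ih =>
    cases k with
    | zero => exact sat_leaf_univ (.box hψ)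
    | succ k =>
      intro y hy
      obtain ⟨u, hu, rfl⟩ := rel_unravel_iff.1 hy
      exact ih (hs u hu)

end ColTree

/-- One more than the modal depth of a formula. -/
def MF.height {α : Type} : MF α → ℕ
  | .and φ ψ => max φ.height ψ.height
  | .or φ ψ => max φ.height ψ.height
  | .dia φ => φ.height + 1
  | .box φ => φ.height + 1
  | _ => 1

theorem ColTree.sat_unravel_iff {α : Type} {n k : ℕ} {c : Set α} {t : ColTree α n} {M : PModel α}
    {φ : MF α} (hk : φ.height ≤ k) {h : k ≤ n} {w : M.World} :
    Sat (model c t) ⟨⟨k, unravel M k w⟩, h⟩ φ ↔ Sat M w φ := by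
  induction φ generalizing k w with
  | top => exact Iff.rfl
  | bot => exact Iff.rfl
  | var p =>
    obtain ⟨k, rfl⟩ := Nat.exists_eq_succ_of_ne_zero (Nat.one_le_iff_ne_zero.1 hk)
    exact Iff.rfl
  | nvar p =>
    obtain ⟨k, rfl⟩ := Nat.exists_eq_succ_of_ne_zero (Nat.one_le_iff_ne_zero.1 hk)
    exact Iff.rfl
  | and φ ψ ih₁ ih₂ =>
    exact and_congr (ih₁ ((le_max_left _ _).trans hk)) (ih₂ ((le_max_right _ _).trans hk))
  | or φ ψ ih₁ ih₂ =>
    exact or_congr (ih₁ ((le_max_left _ _).trans hk)) (ih₂ ((le_max_right _ _).trans hk))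
  | dia φ ih =>
    obtain _ | k := k
    · exact absurd hk (Nat.not_succ_le_zero _)
    have hk := Nat.le_of_succ_le_succ hk
    constructor
    · rintro ⟨y, hy, hs⟩
      obtain ⟨u, hu, rfl⟩ := rel_unravel_iff.1 hy
      exact ⟨u, hu, (ih hk).1 hs⟩
    · rintro ⟨u, hu, hs⟩
      exact ⟨_, rel_unravel_iff.2 ⟨u, hu, rfl⟩, (ih hk).2 hs⟩
  | box φ ih =>
    obtain _ | k := k
    · exact absurd hk (Nat.not_succ_le_zero _)
    have hk := Nat.le_of_succ_le_succ hk
    constructor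
    · exact fun hs u hu => (ih hk).1 (hs _ (rel_unravel_iff.2 ⟨u, hu, rfl⟩))
    · intro hs y hy
      obtain ⟨u, hu, rfl⟩ := rel_unravel_iff.1 hy
      exact (ih hk).2 (hs u hu)

/-- the fragment L_{□,◇,∧,∨}[Prop] admits finite characterisations. -/
theorem posFragment_admits_finChar {α : Type} [Fintype α] (φ : MF α) (hφ : PosForm φ) :
    ∃ Ep En : Set (PModel α), FinCharOf {ψ : MF α | PosForm ψ} φ Ep En := by
  refine ⟨{M | (∃ t : ColTree α φ.height, ColTree.model ∅ t = M) ∧ PSat M φ},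
    {M | (∃ t : ColTree α φ.height, ColTree.model Set.univ t = M) ∧ ¬ PSat M φ},
    (Set.finite_range _).subset fun M hM => hM.1, (Set.finite_range _).subset fun M hM => hM.1,
    ?_, ?_, fun M hM => hM.2, fun M hM => hM.2, fun ψ hψ hp hn M => ⟨fun hs => ?_, fun hs => ?_⟩⟩
  · rintro _ ⟨⟨t, rfl⟩, -⟩
    exact ColTree.finite_world_model ∅ t
  · rintro _ ⟨⟨t, rfl⟩, -⟩
    exact ColTree.finite_world_model Set.univ t
  · by_contra hφM
    exact hn (ColTree.model Set.univ (ColTree.unravel M φ.height M.pt))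
      ⟨⟨_, rfl⟩, fun h => hφM ((ColTree.sat_unravel_iff le_rfl).1 h)⟩
      (ColTree.sat_unravel_univ_of_sat hψ hs)
  · exact ColTree.sat_of_sat_unravel_empty hψ
      (hp (ColTree.model ∅ (ColTree.unravel M φ.height M.pt))
        ⟨⟨_, rfl⟩, (ColTree.sat_unravel_iff le_rfl).2 hs⟩)
end

section
/- For every finite set Prop, the fragment L_{□,◇,∧,⊥}[Prop] does not admit finite characterisations; in particular the formula ⊥ has no finite characterisation with respect to L_{□,◇,∧,⊥}[Prop]: for every pair (E⁺,E⁻) of finite sets of finite pointed models that ⊥ fits (so E⁺ = ∅ and E⁻ arbitrary finite), there exists ψ ∈ L_{□,◇,∧,⊥}[Prop] false at every member of E⁻ but not equivalent to ⊥. -/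
/-- The fragment L_{□,◇,∧,⊥}: formulas built from propositional variables and ⊥
using only the connectives ∧, ◇, □. -/
inductive FragBoxDiaAndBot {α : Type} : MF α → Prop
  | bot : FragBoxDiaAndBot MF.bot
  | var (p : α) : FragBoxDiaAndBot (MF.var p)
  | and {φ ψ : MF α} : FragBoxDiaAndBot φ → FragBoxDiaAndBot ψ → FragBoxDiaAndBot (MF.and φ ψ)
  | dia {φ : MF α} : FragBoxDiaAndBot φ → FragBoxDiaAndBot (MF.dia φ)
  | box {φ : MF α} : FragBoxDiaAndBot φ → FragBoxDiaAndBot (MF.box φ)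

theorem FragBoxDiaAndBot.iterate_dia {α : Type} {φ : MF α} (h : FragBoxDiaAndBot φ) (n : ℕ) :
    FragBoxDiaAndBot (MF.dia^[n] φ) := by
  induction n with
  | zero => exact h
  | succ n ih => rw [Function.iterate_succ_apply']; exact ih.dia

theorem FragBoxDiaAndBot.iterate_box {α : Type} {φ : MF α} (h : FragBoxDiaAndBot φ) (n : ℕ) :
    FragBoxDiaAndBot (MF.box^[n] φ) := by
  induction n with
  | zero => exact h
  | succ n ih => rw [Function.iterate_succ_apply']; exact ih.box

/-- The formula `◇ⁿ□⊥ ∧ □ⁿ⁺¹⊥`, saying that a longest path from the current world exists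
and has length exactly `n`. -/
def heightFormula (α : Type) (n : ℕ) : MF α :=
  MF.and (MF.dia^[n] (MF.box MF.bot)) (MF.box^[n + 1] MF.bot)

theorem fragBoxDiaAndBot_heightFormula (α : Type) (n : ℕ) :
    FragBoxDiaAndBot (heightFormula α n) :=
  (FragBoxDiaAndBot.bot.box.iterate_dia n).and (FragBoxDiaAndBot.bot.iterate_box (n + 1))

/-- If there is a path of length `k` and all paths have length less than `j`, then `k < j`. -/
theorem lt_of_sat_iterate_dia_of_sat_iterate_box {α : Type} {M : PModel α} {χ : MF α} {k j : ℕ}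
    {w : M.World} (hk : Sat M w (MF.dia^[k] χ)) (hj : Sat M w (MF.box^[j] MF.bot)) : k < j := by
  induction j generalizing k w with
  | zero => exact hj.elim
  | succ j ih =>
    cases k with
    | zero => exact j.succ_pos
    | succ k =>
      rw [Function.iterate_succ_apply'] at hk hj
      obtain ⟨u, hwu, hu⟩ := hk
      exact Nat.succ_lt_succ (ih hu (hj u hwu))

theorem exists_sat_heightFormula_of_le {α : Type} {M : PModel α} {n k : ℕ} {w : M.World}
    (hw : Sat M w (heightFormula α n)) (hk : k ≤ n) : ∃ u, Sat M u (heightFormula α k) := by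
  induction n, hk using Nat.le_induction generalizing w with
  | base => exact ⟨w, hw⟩
  | succ n _ ih =>
    obtain ⟨hd, hb⟩ := hw
    rw [Function.iterate_succ_apply'] at hd hb
    obtain ⟨u, hwu, hu⟩ := hd
    exact ih ⟨hu, hb u hwu⟩

/-- A finite model of `heightFormula α n` has more than `n` worlds. -/
theorem lt_card_of_sat_heightFormula {α : Type} {M : PModel α} [Finite M.World] {n : ℕ}
    {w : M.World} (hw : Sat M w (heightFormula α n)) : n < Nat.card M.World := by
  choose f hf using fun k : Fin (n + 1) =>
    exists_sat_heightFormula_of_le hw (Nat.lt_succ_iff.mp k.isLt)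
  have hle : ∀ i j, f i = f j → i ≤ j := fun i j hij =>
    Nat.lt_succ_iff.mp
      (lt_of_sat_iterate_dia_of_sat_iterate_box (hf i).1 (hij ▸ (hf j).2))
  have hinj : Function.Injective f := fun i j hij =>
    le_antisymm (hle i j hij) (hle j i hij.symm)
  simpa [Nat.succ_le_iff] using Nat.card_le_card_of_injective f hinj

/-- The descending chain of natural numbers, pointed at `n`. -/
def chainModel (α : Type) (n : ℕ) : PModel α where
  World := ℕ
  Rel a b := a = b + 1
  val _ := ∅
  pt := n

theorem psat_chainModel_heightFormula (α : Type) (n : ℕ) :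
    PSat (chainModel α n) (heightFormula α n) := by
  suffices h : ∀ k : ℕ, Sat (chainModel α n) k (heightFormula α k) from h n
  intro k
  induction k with
  | zero => exact ⟨fun u hu => Nat.succ_ne_zero u hu.symm, fun u hu => Nat.succ_ne_zero u hu.symm⟩
  | succ k ih =>
    unfold heightFormula
    rw [Function.iterate_succ_apply', Function.iterate_succ_apply' MF.box]
    refine ⟨⟨k, rfl, ih.1⟩, fun u hu => ?_⟩
    obtain rfl : k = u := Nat.succ.inj hu
    exact ih.2

/-- `⊥` has no finite characterisation with respect to L_{□,◇,∧,⊥}: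
for every pair `(E⁺,E⁻)` of finite sets of finite pointed models that `⊥` fits,
there is a formula of the fragment false at every member of `E⁻` but not
equivalent to `⊥`. -/
theorem bot_no_finChar_boxDiaAndBot {α : Type} [Fintype α]
    (Ep En : Set (PModel α)) (hEp : Ep.Finite) (hEn : En.Finite)
    (hEpFin : ∀ M ∈ Ep, Finite M.World) (hEnFin : ∀ M ∈ En, Finite M.World)
    (hpos : ∀ M ∈ Ep, PSat M (MF.bot : MF α))
    (hneg : ∀ M ∈ En, ¬ PSat M (MF.bot : MF α)) :
    ∃ ψ : MF α, FragBoxDiaAndBot ψ ∧ (∀ M ∈ En, ¬ PSat M ψ) ∧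
      ¬ MFEquiv ψ (MF.bot : MF α) := by
  obtain ⟨n, hn⟩ := (hEn.image fun M => Nat.card M.World).bddAbove
  refine ⟨heightFormula α n, fragBoxDiaAndBot_heightFormula α n, fun M hM hsat => ?_,
    fun h => (h (chainModel α n)).mp (psat_chainModel_heightFormula α n)⟩
  have := hEnFin M hM
  exact (lt_card_of_sat_heightFormula hsat).not_ge (hn (Set.mem_image_of_mem _ hM))
end

section
/- Every formula of L_{□,◇,∧,∨}[Prop] is preserved under weak simulations: if there is a weak simulation from (M,s) to (M',s') and M,s ⊨ φ with φ ∈ L_{□,◇,∧,∨}[Prop], then M',s' ⊨ φ. -/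
/-- Repointing a pointed model at another of its worlds. -/
def PModel.repoint {α : Type} (M : PModel α) (w : M.World) : PModel α := { M with pt := w }

/-- `Z` is a bisimulation between the pointed models `M` and `M'`. -/
def IsBisim {α : Type} (M M' : PModel α) (Z : M.World → M'.World → Prop) : Prop :=
  Z M.pt M'.pt ∧ ∀ t t', Z t t' →
    (M.val t = M'.val t') ∧
    (∀ u, M.Rel t u → ∃ u', M'.Rel t' u' ∧ Z u u') ∧
    (∀ u', M'.Rel t' u' → ∃ u, M.Rel t u ∧ Z u u')

/-- Two pointed models are bisimilar if some bisimulation relates them. -/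
def Bisimilar {α : Type} (M M' : PModel α) : Prop := ∃ Z, IsBisim M M' Z

/-- The empty loopstate: a single reflexive world with empty colour. -/
def emptyLoop (α : Type) : PModel α := ⟨Unit, fun _ _ => True, fun _ => ∅, ()⟩

/-- The full loopstate: a single reflexive world whose colour is all of `Prop`. -/
def fullLoop (α : Type) : PModel α := ⟨Unit, fun _ _ => True, fun _ => Set.univ, ()⟩

/-- `Z` is a weak simulation from the pointed model `M` to the pointed model `M'`. -/
def IsWeakSim {α : Type} (M M' : PModel α) (Z : M.World → M'.World → Prop) : Prop :=
  Z M.pt M'.pt ∧ ∀ t t', Z t t' →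
    (M.val t ⊆ M'.val t') ∧
    (∀ u, M.Rel t u →
      Bisimilar (M.repoint u) (emptyLoop α) ∨ ∃ u', M'.Rel t' u' ∧ Z u u') ∧
    (∀ u', M'.Rel t' u' →
      Bisimilar (M'.repoint u') (fullLoop α) ∨ ∃ u, M.Rel t u ∧ Z u u')

/-- `(M,s) ⇁ (M',s')`: some weak simulation from `M` to `M'` exists. -/
def WSim {α : Type} (M M' : PModel α) : Prop := ∃ Z, IsWeakSim M M' Z

/-- Bisimulations preserve and reflect all modal formulas. -/
theorem IsBisim.sat_iff {α : Type} {M M' : PModel α} {Z : M.World → M'.World → Prop}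
    (hZ : IsBisim M M' Z) (φ : MF α) {t : M.World} {t' : M'.World} (h : Z t t') :
    Sat M t φ ↔ Sat M' t' φ := by
  induction φ generalizing t t' with
  | top => exact Iff.rfl
  | bot => exact Iff.rfl
  | var p => simp only [Sat, (hZ.2 t t' h).1]
  | nvar p => simp only [Sat, (hZ.2 t t' h).1]
  | and φ ψ ihφ ihψ => exact and_congr (ihφ h) (ihψ h)
  | or φ ψ ihφ ihψ => exact or_congr (ihφ h) (ihψ h)
  | dia φ ih =>
    obtain ⟨-, hforth, hback⟩ := hZ.2 t t' h
    constructor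
    · rintro ⟨u, hu, hs⟩
      obtain ⟨u', hu', hz⟩ := hforth u hu
      exact ⟨u', hu', (ih hz).1 hs⟩
    · rintro ⟨u', hu', hs⟩
      obtain ⟨u, hu, hz⟩ := hback u' hu'
      exact ⟨u, hu, (ih hz).2 hs⟩
  | box φ ih =>
    obtain ⟨-, hforth, hback⟩ := hZ.2 t t' h
    constructor
    · intro hs u' hu'
      obtain ⟨u, hu, hz⟩ := hback u' hu'
      exact (ih hz).1 (hs u hu)
    · intro hs u hu
      obtain ⟨u', hu', hz⟩ := hforth u hu
      exact (ih hz).2 (hs u' hu')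

theorem Bisimilar.pSat_iff {α : Type} {M M' : PModel α} (h : Bisimilar M M') (φ : MF α) :
    PSat M φ ↔ PSat M' φ :=
  let ⟨_, hZ⟩ := h
  hZ.sat_iff φ hZ.1

theorem sat_repoint {α : Type} (M : PModel α) (u w : M.World) (φ : MF α) :
    Sat (M.repoint u) w φ ↔ Sat M w φ := by
  induction φ generalizing w with
  | top | bot | var | nvar => exact Iff.rfl
  | and φ ψ ihφ ihψ => exact and_congr (ihφ w) (ihψ w)
  | or φ ψ ihφ ihψ => exact or_congr (ihφ w) (ihψ w)
  | dia φ ih => exact exists_congr fun v => and_congr_right fun _ => ih v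
  | box φ ih => exact forall_congr' fun v => imp_congr_right fun _ => ih v

/-- No formula of the fragment holds at the empty loopstate. -/
theorem PosForm.not_sat_emptyLoop {α : Type} {φ : MF α} (hφ : PosForm φ) :
    ¬ Sat (emptyLoop α) () φ := by
  induction hφ with
  | var p => exact fun h => h
  | and _ _ ih _ => exact fun h => ih h.1
  | or _ _ ihφ ihψ => exact fun h => h.elim ihφ ihψ
  | dia _ ih => exact fun ⟨_, _, h⟩ => ih h
  | box _ ih => exact fun h => ih (h () trivial)

/-- Every formula of the fragment holds at the full loopstate. -/
theorem PosForm.sat_fullLoop {α : Type} {φ : MF α} (hφ : PosForm φ) :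
    Sat (fullLoop α) () φ := by
  induction hφ with
  | var p => exact Set.mem_univ p
  | and _ _ ihφ ihψ => exact ⟨ihφ, ihψ⟩
  | or _ _ ih _ => exact Or.inl ih
  | dia _ ih => exact ⟨(), trivial, ih⟩
  | box _ ih => exact fun _ _ => ih

/-- Weak simulations preserve the formulas of the fragment at all related worlds. -/
theorem IsWeakSim.sat {α : Type} {M M' : PModel α} {Z : M.World → M'.World → Prop}
    (hZ : IsWeakSim M M' Z) {φ : MF α} (hφ : PosForm φ) {t : M.World} {t' : M'.World}
    (h : Z t t') (hs : Sat M t φ) : Sat M' t' φ := by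
  induction hφ generalizing t t' with
  | var p => exact (hZ.2 t t' h).1 hs
  | and _ _ ihφ ihψ => exact ⟨ihφ h hs.1, ihψ h hs.2⟩
  | or _ _ ihφ ihψ => exact hs.imp (ihφ h) (ihψ h)
  | @dia φ hφ ih =>
    obtain ⟨u, hu, hsu⟩ := hs
    obtain hb | ⟨u', hu', hz⟩ := (hZ.2 t t' h).2.1 u hu
    · exact absurd ((hb.pSat_iff φ).1 ((sat_repoint M u u φ).2 hsu)) hφ.not_sat_emptyLoop
    · exact ⟨u', hu', ih hz hsu⟩
  | @box φ hφ ih =>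
    intro u' hu'
    obtain hb | ⟨u, hu, hz⟩ := (hZ.2 t t' h).2.2 u' hu'
    · exact (sat_repoint M' u' u' φ).1 ((hb.pSat_iff φ).2 hφ.sat_fullLoop)
    · exact ih hz (hs u hu)

/-- every formula of L_{□,◇,∧,∨}[Prop] is preserved under weak
simulations. -/
theorem posForm_preserved_wsim {α : Type} [Fintype α] {φ : MF α} (hφ : PosForm φ)
    {M M' : PModel α} (h : WSim M M') (hsat : PSat M φ) : PSat M' φ := by
  obtain ⟨Z, hZ⟩ := h
  exact hZ.sat hφ hZ.1 hsat
end

section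
/- Let Prop = {p,q,r}. Let (A,a) be the pointed model with worlds {a,v,u,s,t}, edges a→v, a→u, v→s, u→t, s→s, t→t, and colours v(v)={p}, v(u)={q}, all other colours ∅. Let (B,b) be the pointed model with worlds {b,v',u',s'}, edges b→v', b→u', v'→s', s'→s', u'→u', and colours v(v')={r}, all other colours ∅. Then there is no pointed model (D,d) with (A,a) ⇁ (D,d) and (B,b) ⇁ (D,d) such that (D,d) ⇁ (C,c) holds for every pointed model (C,c) with (A,a) ⇁ (C,c) and (B,b) ⇁ (C,c). Consequently, the category of pointed models and weak simulations does not have coproducts. -/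
/-- The pointed model (A,a): worlds a=0, v=1, u=2, s=3, t=4; edges a→v, a→u,
v→s, u→t, s→s, t→t; colours v(v)={p}, v(u)={q} (p=0, q=1, r=2), all others ∅. -/
def modelA : PModel (Fin 3) where
  World := Fin 5
  Rel := fun x y =>
    (x = 0 ∧ y = 1) ∨ (x = 0 ∧ y = 2) ∨ (x = 1 ∧ y = 3) ∨
    (x = 2 ∧ y = 4) ∨ (x = 3 ∧ y = 3) ∨ (x = 4 ∧ y = 4)
  val := fun x => if x = 1 then {0} else if x = 2 then {1} else ∅
  pt := 0

/-- The pointed model (B,b): worlds b=0, v'=1, u'=2, s'=3; edges b→v', b→u',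
v'→s', s'→s', u'→u'; colours v(v')={r} (r=2), all others ∅. -/
def modelB : PModel (Fin 3) where
  World := Fin 4
  Rel := fun x y =>
    (x = 0 ∧ y = 1) ∨ (x = 0 ∧ y = 2) ∨ (x = 1 ∧ y = 3) ∨
    (x = 3 ∧ y = 3) ∨ (x = 2 ∧ y = 2)
  val := fun x => if x = 1 then {2} else ∅
  pt := 0

/-- A root of empty colour with two terminal successors, coloured `X` and `Y`. -/
def fork {α : Type} (X Y : Set α) : PModel α where
  World := Fin 3
  Rel := fun x y => x = 0 ∧ y ≠ 0
  val := fun x => if x = 1 then X else if x = 2 then Y else ∅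
  pt := 0

/-- A pointed model whose point has nonempty colour is not bisimilar to the empty loopstate. -/
theorem not_bisimilar_emptyLoop {α : Type} {M : PModel α} {w : M.World} {i : α}
    (hi : i ∈ M.val w) : ¬ Bisimilar (M.repoint w) (emptyLoop α) := by
  rintro ⟨Z, hZ, h⟩
  have h1 : M.val w = ∅ := (h _ _ hZ).1
  simp [h1] at hi

/-- A pointed model bisimilar to the full loopstate has full colour. -/
theorem val_eq_univ_of_bisimilar_fullLoop {α : Type} {M : PModel α} {w : M.World}
    (h : Bisimilar (M.repoint w) (fullLoop α)) : M.val w = Set.univ := by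
  obtain ⟨Z, hZ, h⟩ := h
  exact (h _ _ hZ).1

/-- A world of empty colour whose only successor is itself is bisimilar to the empty loopstate. -/
theorem bisimilar_emptyLoop {α : Type} {M : PModel α} {w : M.World} (hval : M.val w = ∅)
    (hrefl : M.Rel w w) (hsucc : ∀ u, M.Rel w u → u = w) :
    Bisimilar (M.repoint w) (emptyLoop α) := by
  refine ⟨fun x _ => x = w, rfl, ?_⟩
  rintro (t : M.World) - (ht : t = w)
  subst ht
  exact ⟨hval, fun u hu => ⟨(), trivial, hsucc u hu⟩, fun _ _ => ⟨t, hrefl, rfl⟩⟩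

theorem modelA_bisimilar_emptyLoop {w : Fin 5} (hw : w = 3 ∨ w = 4) :
    Bisimilar (modelA.repoint w) (emptyLoop (Fin 3)) := by
  apply bisimilar_emptyLoop <;> rcases hw with rfl | rfl <;> simp [modelA]

theorem modelB_bisimilar_emptyLoop {w : Fin 4} (hw : w = 2 ∨ w = 3) :
    Bisimilar (modelB.repoint w) (emptyLoop (Fin 3)) := by
  apply bisimilar_emptyLoop <;> rcases hw with rfl | rfl <;> simp [modelB]

theorem modelA_wsim_fork {X Y : Set (Fin 3)} (hX : 0 ∈ X) (hY : 1 ∈ Y) :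
    WSim modelA (fork X Y) := by
  refine ⟨fun (t : Fin 5) (t' : Fin 3) => modelA.val t ⊆ (fork X Y).val t' ∧ (t = 0 ↔ t' = 0),
    ⟨by simp [modelA, fork], by simp [modelA, fork]⟩, ?_⟩
  rintro (t : Fin 5) (t' : Fin 3) ⟨hval, h0⟩
  refine ⟨hval, fun (u : Fin 5) hu => ?_, fun (u' : Fin 3) hu' => ?_⟩
  · rcases hu with ⟨rfl, rfl⟩ | ⟨rfl, rfl⟩ | ⟨rfl, rfl⟩ | ⟨rfl, rfl⟩ | ⟨rfl, rfl⟩ | ⟨rfl, rfl⟩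
    · exact Or.inr ⟨(1 : Fin 3), ⟨h0.1 rfl, by decide⟩, by simpa [modelA, fork] using hX, by decide⟩
    · exact Or.inr ⟨(2 : Fin 3), ⟨h0.1 rfl, by decide⟩, by simpa [modelA, fork] using hY, by decide⟩
    all_goals exact Or.inl (modelA_bisimilar_emptyLoop (by decide))
  · obtain ⟨rfl, hu'⟩ := hu'
    obtain rfl : t = 0 := h0.2 rfl
    have h12 : u' = 1 ∨ u' = 2 := by omega
    rcases h12 with rfl | rfl
    · exact Or.inr ⟨(1 : Fin 5), by simp [modelA], by simpa [modelA, fork] using hX, by decide⟩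
    · exact Or.inr ⟨(2 : Fin 5), by simp [modelA], by simpa [modelA, fork] using hY, by decide⟩

theorem modelB_wsim_fork {X Y : Set (Fin 3)} (h : 2 ∈ X ∨ 2 ∈ Y) :
    WSim modelB (fork X Y) := by
  refine ⟨fun (t : Fin 4) (t' : Fin 3) => modelB.val t ⊆ (fork X Y).val t' ∧ (t = 0 ↔ t' = 0),
    ⟨by simp [modelB, fork], by simp [modelB, fork]⟩, ?_⟩
  rintro (t : Fin 4) (t' : Fin 3) ⟨hval, h0⟩
  refine ⟨hval, fun (u : Fin 4) hu => ?_, fun (u' : Fin 3) hu' => ?_⟩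
  · rcases hu with ⟨rfl, rfl⟩ | ⟨rfl, rfl⟩ | ⟨rfl, rfl⟩ | ⟨rfl, rfl⟩ | ⟨rfl, rfl⟩
    · rcases h with h | h
      · exact Or.inr ⟨(1 : Fin 3), ⟨h0.1 rfl, by decide⟩, by simpa [modelB, fork] using h, by decide⟩
      · exact Or.inr ⟨(2 : Fin 3), ⟨h0.1 rfl, by decide⟩, by simpa [modelB, fork] using h, by decide⟩
    all_goals exact Or.inl (modelB_bisimilar_emptyLoop (by decide))
  · obtain ⟨rfl, hu'⟩ := hu'
    obtain rfl : t = 0 := h0.2 rfl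
    exact Or.inr ⟨(2 : Fin 4), by simp [modelB], by simp [modelB], by simpa using hu'⟩

/-- Every successor of the point of a model weakly simulating `modelA` has colour `p` or `q`. -/
theorem mem_val_of_modelA_wsim {D : PModel (Fin 3)} (h : WSim modelA D) {w : D.World}
    (hw : D.Rel D.pt w) : 0 ∈ D.val w ∨ 1 ∈ D.val w := by
  obtain ⟨Z, hZ, h⟩ := h
  rcases (h _ _ hZ).2.2 w hw with hb | ⟨u, hu, huw⟩
  · simp [val_eq_univ_of_bisimilar_fullLoop hb]
  · have hval := (h _ _ huw).1
    rcases hu with ⟨_, rfl⟩ | ⟨_, rfl⟩ | ⟨hu, _⟩ | ⟨hu, _⟩ | ⟨hu, _⟩ | ⟨hu, _⟩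
    · left; simpa [modelA] using hval
    · right; simpa [modelA] using hval
    all_goals simp [modelA] at hu

/-- The point of a model weakly simulating `modelB` has a successor with colour `r`. -/
theorem exists_mem_val_of_modelB_wsim {D : PModel (Fin 3)} (h : WSim modelB D) :
    ∃ w, D.Rel D.pt w ∧ 2 ∈ D.val w := by
  obtain ⟨Z, hZ, h⟩ := h
  rcases (h _ _ hZ).2.1 (1 : Fin 4) (by simp [modelB]) with hb | ⟨u', hu', hz⟩
  · exact absurd hb (not_bisimilar_emptyLoop (i := 2) (by simp [modelB]))
  · exact ⟨u', hu', by simpa [modelB] using (h _ _ hz).1⟩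

/-- A coloured successor of the point of `D` embeds its colour in one of the tips of the fork. -/
theorem val_subset_of_wsim_fork {α : Type} {D : PModel α} {X Y : Set α}
    (h : WSim D (fork X Y)) {w : D.World} (hw : D.Rel D.pt w) {i : α} (hi : i ∈ D.val w) :
    D.val w ⊆ X ∨ D.val w ⊆ Y := by
  obtain ⟨Z, hZ, h⟩ := h
  rcases (h _ _ hZ).2.1 w hw with hb | ⟨(u : Fin 3), hu, hz⟩
  · exact absurd hb (not_bisimilar_emptyLoop hi)
  · have h12 : u = 1 ∨ u = 2 := by
      have : u ≠ 0 := hu.2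
      omega
    have hval := (h _ _ hz).1
    rcases h12 with rfl | rfl
    · left; simpa [fork] using hval
    · right; simpa [fork] using hval

/-- there is no pointed model `(D,d)` weakly simulating both `(A,a)`
and `(B,b)` that is weakly simulated by every common upper bound of `(A,a)` and
`(B,b)`; hence the category of pointed models and weak simulations has no
coproduct of `(A,a)` and `(B,b)`, so it does not have coproducts. -/
theorem no_coproduct_modelA_modelB :
    ¬ ∃ D : PModel (Fin 3), WSim modelA D ∧ WSim modelB D ∧
        ∀ C : PModel (Fin 3), WSim modelA C → WSim modelB C → WSim D C := by
  rintro ⟨D, hA, hB, hD⟩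
  obtain ⟨w, hw, hr⟩ := exists_mem_val_of_modelB_wsim hB
  rcases mem_val_of_modelA_wsim hA hw with hp | hq
  · have hf := hD (fork {0} {1, 2}) (modelA_wsim_fork (by simp) (by simp))
      (modelB_wsim_fork (by simp))
    rcases val_subset_of_wsim_fork hf hw hr with h | h
    · simpa using h hr
    · simpa using h hp
  · have hf := hD (fork {0, 2} {1}) (modelA_wsim_fork (by simp) (by simp))
      (modelB_wsim_fork (by simp))
    rcases val_subset_of_wsim_fork hf hw hr with h | h
    · simpa using h hq
    · simpa using h hr
end

section
/- If Z is a weak simulation from (E,e) to (M,s), then the converse relation Z⁻¹ = {(b,a) : (a,b) ∈ Z} is a weak simulation from (M¬,s) to (E¬,e), where N¬ denotes the model N with all colours complemented. -/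
/-- `M¬`: the model `M` with all colours complemented. -/
def PModel.negM {α : Type} (M : PModel α) : PModel α :=
  { M with val := fun t => (M.val t)ᶜ }

theorem Bisimilar.negM {α : Type} {M M' : PModel α} (h : Bisimilar M M') :
    Bisimilar M.negM M'.negM := by
  obtain ⟨Z, hpt, hZ⟩ := h
  exact ⟨Z, hpt, fun t t' htt' => ⟨congrArg compl (hZ t t' htt').1, (hZ t t' htt').2⟩⟩

theorem negM_emptyLoop (α : Type) : (emptyLoop α).negM = fullLoop α := by
  simp [PModel.negM, emptyLoop, fullLoop]

theorem negM_fullLoop (α : Type) : (fullLoop α).negM = emptyLoop α := by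
  simp [PModel.negM, emptyLoop, fullLoop]

/-- if `Z` is a weak simulation from `(E,e)` to `(M,s)`, then the
converse relation `Z⁻¹` is a weak simulation from `(M¬,s)` to `(E¬,e)`. -/
theorem wsim_converse_neg {α : Type} [Fintype α] {E M : PModel α}
    {Z : E.World → M.World → Prop} (h : IsWeakSim E M Z) :
    IsWeakSim M.negM E.negM (fun b a => Z a b) := by
  obtain ⟨hpt, hZ⟩ := h
  refine ⟨hpt, fun b a hab => ?_⟩
  obtain ⟨hval, hforth, hback⟩ := hZ a b hab
  refine ⟨Set.compl_subset_compl.mpr hval, fun u hu => ?_, fun u hu => ?_⟩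
  · exact (hback u hu).imp_left fun hb => negM_fullLoop α ▸ hb.negM
  · exact (hforth u hu).imp_left fun hb => negM_emptyLoop α ▸ hb.negM
end

section
/- If (D⁺,D⁻) is a weak simulation duality and φ ∈ L_{□,◇,∧,∨}[Prop] is true at every member of D⁺ (labelled positive) and false at every member of D⁻ (labelled negative), then (D⁺,D⁻) is a finite characterisation of φ with respect to L_{□,◇,∧,∨}[Prop]: every ψ ∈ L_{□,◇,∧,∨}[Prop] true at all members of D⁺ and false at all members of D⁻ is equivalent to φ. -/
/-- A weak simulation duality: a pair `(Dp, Dn)` of finite sets of finite pointed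
models such that every pointed model either weakly simulates some member of `Dp`
or is weakly simulated by some member of `Dn`, and never both. -/
def WSimDuality {α : Type} (Dp Dn : Set (PModel α)) : Prop :=
  Dp.Finite ∧ Dn.Finite ∧
  (∀ M ∈ Dp, Finite M.World) ∧ (∀ M ∈ Dn, Finite M.World) ∧
  (∀ M : PModel α, (∃ E ∈ Dp, WSim E M) ↔ ¬ (∃ E ∈ Dn, WSim M E))

theorem PosForm.not_sat_of_bisimilar_emptyLoop {α : Type} {M : PModel α} {w : M.World}
    {φ : MF α} (hφ : PosForm φ) (h : Bisimilar (M.repoint w) (emptyLoop α)) :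
    ¬ Sat M w φ := by
  induction hφ generalizing w with
  | var p =>
    intro hp
    obtain ⟨Z, hw, hZ⟩ := h
    have hv : M.val w = ∅ := (hZ _ _ hw).1
    exact Set.eq_empty_iff_forall_notMem.mp hv p hp
  | and _ _ ih₁ _ => exact fun hs => ih₁ h hs.1
  | or _ _ ih₁ ih₂ => exact fun hs => hs.elim (ih₁ h) (ih₂ h)
  | dia _ ih =>
    rintro ⟨u, hwu, hu⟩
    obtain ⟨Z, hw, hZ⟩ := h
    obtain ⟨_, _, hZu⟩ := (hZ _ _ hw).2.1 u hwu
    exact ih (w := u) ⟨Z, hZu, hZ⟩ hu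
  | box _ ih =>
    intro hs
    obtain ⟨Z, hw, hZ⟩ := h
    obtain ⟨u, hwu, hZu⟩ := (hZ _ _ hw).2.2 () trivial
    exact ih (w := u) ⟨Z, hZu, hZ⟩ (hs u hwu)

theorem PosForm.sat_of_bisimilar_fullLoop {α : Type} {M : PModel α} {w : M.World}
    {φ : MF α} (hφ : PosForm φ) (h : Bisimilar (M.repoint w) (fullLoop α)) :
    Sat M w φ := by
  induction hφ generalizing w with
  | var p =>
    obtain ⟨Z, hw, hZ⟩ := h
    have hv : M.val w = Set.univ := (hZ _ _ hw).1
    exact Set.eq_univ_iff_forall.mp hv p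
  | and _ _ ih₁ ih₂ => exact ⟨ih₁ h, ih₂ h⟩
  | or _ _ ih₁ _ => exact Or.inl (ih₁ h)
  | dia _ ih =>
    obtain ⟨Z, hw, hZ⟩ := h
    obtain ⟨u, hwu, hZu⟩ := (hZ _ _ hw).2.2 () trivial
    exact ⟨u, hwu, ih ⟨Z, hZu, hZ⟩⟩
  | box _ ih =>
    intro u hwu
    obtain ⟨Z, hw, hZ⟩ := h
    obtain ⟨_, _, hZu⟩ := (hZ _ _ hw).2.1 u hwu
    exact ih ⟨Z, hZu, hZ⟩

/-- Formulas of the fragment are preserved along weak simulations. -/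
theorem PosForm.pSat_of_wSim {α : Type} {M M' : PModel α} {φ : MF α} (hφ : PosForm φ)
    (h : WSim M M') (hM : PSat M φ) : PSat M' φ := by
  obtain ⟨Z, hpt, hZ⟩ := h
  suffices H : ∀ t t', Z t t' → Sat M t φ → Sat M' t' φ from H _ _ hpt hM
  clear hM hpt
  induction hφ with
  | var p => exact fun t t' ht hp => (hZ t t' ht).1 hp
  | and _ _ ih₁ ih₂ => exact fun t t' ht h => ⟨ih₁ t t' ht h.1, ih₂ t t' ht h.2⟩
  | or _ _ ih₁ ih₂ => exact fun t t' ht h => h.imp (ih₁ t t' ht) (ih₂ t t' ht)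
  | dia hψ ih =>
    rintro t t' ht ⟨u, htu, hu⟩
    rcases (hZ t t' ht).2.1 u htu with hb | ⟨u', htu', huu'⟩
    · exact absurd hu (hψ.not_sat_of_bisimilar_emptyLoop hb)
    · exact ⟨u', htu', ih u u' huu' hu⟩
  | box hψ ih =>
    intro t t' ht h u' htu'
    rcases (hZ t t' ht).2.2 u' htu' with hb | ⟨u, htu, huu'⟩
    · exact hψ.sat_of_bisimilar_fullLoop hb
    · exact ih u u' huu' (h u htu)

/-- Of two formulas of the fragment, one false on `Dn` entails one true on `Dp`. -/
theorem WSimDuality.pSat_of_pSat {α : Type} {Dp Dn : Set (PModel α)}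
    (hdual : WSimDuality Dp Dn) {φ ψ : MF α} (hφ : PosForm φ) (hψ : PosForm ψ)
    (hpos : ∀ M ∈ Dp, PSat M φ) (hneg : ∀ M ∈ Dn, ¬ PSat M ψ) {M : PModel α}
    (hM : PSat M ψ) : PSat M φ := by
  obtain ⟨E, hE, hEM⟩ := (hdual.2.2.2.2 M).2 fun ⟨E, hE, hME⟩ =>
    hneg E hE (hψ.pSat_of_wSim hME hM)
  exact hφ.pSat_of_wSim hEM (hpos E hE)

/-- if `(Dp, Dn)` is a weak simulation duality fitted by a formula
`φ ∈ L_{□,◇,∧,∨}[Prop]` (true at every member of `Dp`, false at every member of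
`Dn`), then it is a finite characterisation of `φ` with respect to
L_{□,◇,∧,∨}[Prop]: every formula of the fragment fitting it is equivalent to `φ`. -/
theorem duality_is_finChar {α : Type} [Fintype α] {Dp Dn : Set (PModel α)}
    (hdual : WSimDuality Dp Dn) {φ : MF α} (hφ : PosForm φ)
    (hpos : ∀ M ∈ Dp, PSat M φ) (hneg : ∀ M ∈ Dn, ¬ PSat M φ) :
    ∀ ψ : MF α, PosForm ψ → (∀ M ∈ Dp, PSat M ψ) → (∀ M ∈ Dn, ¬ PSat M ψ) →
      MFEquiv ψ φ := by
  exact fun ψ hψ hψpos hψneg M =>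
    ⟨hdual.pSat_of_pSat hφ hψ hpos hψneg, hdual.pSat_of_pSat hψ hφ hψpos hneg⟩
end

section
/- Every finite characterisation of the formula □ⁿp with respect to L_{□,◇,∧,∨}[{p}] contains at least tower(n,2) positive examples, where tower(1,m) = m and tower(k+1,m) = 2^tower(k,m). Dually, every finite characterisation of ◇ⁿp with respect to L_{□,◇,∧,∨}[{p}] contains at least tower(n,2) negative examples. -/
/-- `□ⁿφ`. -/
def boxIter {α : Type} : ℕ → MF α → MF α
  | 0, φ => φ
  | n+1, φ => MF.box (boxIter n φ)

/-- `◇ⁿφ`. -/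
def diaIter {α : Type} : ℕ → MF α → MF α
  | 0, φ => φ
  | n+1, φ => MF.dia (diaIter n φ)

/-- The tower function: `tower 1 m = m` and `tower (k+1) m = 2 ^ tower k m`
(for `k ≥ 1`). -/
def tower : ℕ → ℕ → ℕ
  | 0, m => m
  | 1, m => m
  | k+2, m => 2 ^ tower (k+1) m

/-- The conjunction of a nonempty finite family of positive formulas is positive. -/
theorem exists_posForm_conj {α ι : Type} (f : ι → MF α) (hf : ∀ i, PosForm (f i))
    {s : Finset ι} (hs : s.Nonempty) :
    ∃ φ, PosForm φ ∧ ∀ (M : PModel α) w, Sat M w φ ↔ ∀ i ∈ s, Sat M w (f i) := by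
  induction hs using Finset.Nonempty.cons_induction with
  | singleton a => exact ⟨f a, hf a, by simp⟩
  | cons a s _ _ ih =>
    obtain ⟨φ, hφ, h⟩ := ih
    exact ⟨.and (f a) φ, .and (hf a) hφ, by simp [Sat, h]⟩

/-- The disjunction of a nonempty finite family of positive formulas is positive. -/
theorem exists_posForm_disj {α ι : Type} (f : ι → MF α) (hf : ∀ i, PosForm (f i))
    {s : Finset ι} (hs : s.Nonempty) :
    ∃ φ, PosForm φ ∧ ∀ (M : PModel α) w, Sat M w φ ↔ ∃ i ∈ s, Sat M w (f i) := by
  induction hs using Finset.Nonempty.cons_induction with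
  | singleton a => exact ⟨f a, hf a, by simp⟩
  | cons a s _ _ ih =>
    obtain ⟨φ, hφ, h⟩ := ih
    exact ⟨.or (f a) φ, .or (hf a) hφ, by simp [Sat, h]⟩

theorem posForm_boxIter {α : Type} {φ : MF α} (hφ : PosForm φ) : ∀ n, PosForm (boxIter n φ)
  | 0 => hφ
  | n + 1 => .box (posForm_boxIter hφ n)

/-- The accessibility relation of `joinModel`. -/
inductive JoinRel {α ι : Type} (K : ι → PModel α) :
    Option (Σ i, (K i).World) → Option (Σ i, (K i).World) → Prop
  | root (i : ι) : JoinRel K none (some ⟨i, (K i).pt⟩)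
  | step (i : ι) {w u : (K i).World} : (K i).Rel w u → JoinRel K (some ⟨i, w⟩) (some ⟨i, u⟩)

/-- The disjoint union of the models `K i` below a fresh root, whose successors are the
distinguished points of the `K i`. -/
def joinModel {α ι : Type} (K : ι → PModel α) : PModel α where
  World := Option (Σ i, (K i).World)
  Rel := JoinRel K
  val
    | none => ∅
    | some x => (K x.1).val x.2
  pt := none

theorem sat_joinModel_some {α ι : Type} (K : ι → PModel α) (i : ι) (φ : MF α) :
    ∀ w : (K i).World, Sat (joinModel K) (some ⟨i, w⟩) φ ↔ Sat (K i) w φ := by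
  induction φ with
  | top | bot | var | nvar => exact fun _ => Iff.rfl
  | and φ ψ ihφ ihψ | or φ ψ ihφ ihψ => intro w; simp only [Sat, ihφ, ihψ]
  | dia φ ih =>
    intro w
    constructor
    · rintro ⟨_, ⟨_⟩ | ⟨_, h⟩, hu⟩
      exact ⟨_, h, (ih _).1 hu⟩
    · rintro ⟨u, h, hu⟩
      exact ⟨_, .step i h, (ih u).2 hu⟩
  | box φ ih =>
    intro w
    constructor
    · exact fun H u h => (ih u).1 (H _ (.step i h))
    · rintro H _ (⟨_⟩ | ⟨_, h⟩)
      exact (ih _).2 (H _ h)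

theorem pSat_joinModel_box {α ι : Type} (K : ι → PModel α) (φ : MF α) :
    PSat (joinModel K) (.box φ) ↔ ∀ i, PSat (K i) φ := by
  constructor
  · exact fun H i => (sat_joinModel_some K i φ _).1 (H _ (.root i))
  · rintro H _ ⟨i⟩
    exact (sat_joinModel_some K i φ _).2 (H i)

theorem pSat_joinModel_dia {α ι : Type} (K : ι → PModel α) (φ : MF α) :
    PSat (joinModel K) (.dia φ) ↔ ∃ i, PSat (K i) φ := by
  constructor
  · rintro ⟨_, ⟨i⟩, h⟩
    exact ⟨i, (sat_joinModel_some K i φ _).1 h⟩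
  · rintro ⟨i, h⟩
    exact ⟨_, .root i, (sat_joinModel_some K i φ _).2 h⟩

/-- A family of positive formulas strictly stronger than `χ` such that every world satisfying `χ`
falsifies at most one member of the family. -/
structure IsSeparating {α ι : Type} (χ : MF α) (ψ : ι → MF α) : Prop where
  posForm : ∀ i, PosForm (ψ i)
  sat : ∀ i (M : PModel α) w, Sat M w (ψ i) → Sat M w χ
  exists_not : ∀ i, ∃ M : PModel α, PSat M χ ∧ ¬ PSat M (ψ i)
  unique : ∀ i j (M : PModel α) w, Sat M w χ → ¬ Sat M w (ψ i) → ¬ Sat M w (ψ j) → i = j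

theorem isSeparating_var {α : Type} (p : α) :
    IsSeparating (.var p) fun _ : Unit => .and (.var p) (.box (.var p)) where
  posForm _ := .and (.var p) (.box (.var p))
  sat _ _ _ h := h.1
  exists_not _ :=
    ⟨⟨Bool, fun _ b => b = false, fun b => {_q | b = true}, true⟩, by simp [PSat, Sat]⟩
  unique _ _ _ _ _ _ _ := rfl

open Classical in
/-- A separating family for `χ` indexed by `ι` gives one for `□χ` indexed by the subsets of `ι`:
the formula at `X` is falsified only where `X` is the set of the `i` such that some successor
falsifies `ψ i`. -/
theorem IsSeparating.box {α ι : Type} [Fintype ι] [Nonempty ι] {χ : MF α} {ψ : ι → MF α}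
    (hχ : PosForm χ) (h : IsSeparating χ ψ) :
    ∃ ψ' : Set ι → MF α, IsSeparating (.box χ) ψ' := by
  choose c hcpos hc using fun i => exists_posForm_conj (fun j => if j = i then χ else ψ j)
    (fun j => by split_ifs; exacts [hχ, h.posForm j]) (Finset.univ_nonempty (α := ι))
  choose d hdpos hd using fun X : Set ι =>
    exists_posForm_disj (fun i => if i ∈ X then .box (ψ i) else .dia (c i))
      (fun i => by split_ifs; exacts [.box (h.posForm i), .dia (hcpos i)])
      (Finset.univ_nonempty (α := ι))
  have key : ∀ X (M : PModel α) w, Sat M w (.box χ) → ¬ Sat M w (d X) →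
      ∀ i, i ∈ X ↔ ∃ u, M.Rel w u ∧ ¬ Sat M u (ψ i) := by
    intro X M w hw hX i
    simp only [hd, Finset.mem_univ, true_and, not_exists] at hX
    constructor
    · intro hi
      have := hX i
      simpa [hi, Sat] using this
    · rintro ⟨u, hu, hui⟩
      by_contra hi
      have := hX i
      rw [if_neg hi] at this
      refine this ⟨u, hu, (hc i M u).2 fun j _ => ?_⟩
      split_ifs with hj
      · exact hw u hu
      · by_contra hj'
        exact hj (h.unique j i M u (hw u hu) hj' hui)
  refine ⟨fun X => .and (.box χ) (d X), fun X => .and (.box hχ) (hdpos X), fun X M w hw => hw.1,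
    fun X => ?_, fun X Y M w hw hX hY => ?_⟩
  · choose K hK hK' using h.exists_not
    have hbox : PSat (joinModel fun i : X => K i) (.box χ) :=
      (pSat_joinModel_box _ χ).2 fun i => hK i
    refine ⟨_, hbox, fun hn => ?_⟩
    obtain ⟨i, -, hi⟩ := (hd X _ _).1 hn.2
    split_ifs at hi with hiX
    · exact hK' i ((pSat_joinModel_box _ _).1 hi ⟨i, hiX⟩)
    · obtain ⟨⟨k, hk⟩, hki⟩ := (pSat_joinModel_dia _ _).1 hi
      have := (hc i _ _).1 hki k (Finset.mem_univ k)
      rw [if_neg (fun hk' : k = i => hiX (hk' ▸ hk))] at this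
      exact hK' k this
  · ext i
    rw [key X M w hw (fun hd' => hX ⟨hw, hd'⟩), key Y M w hw (fun hd' => hY ⟨hw, hd'⟩)]

theorem exists_isSeparating_boxIter {α : Type} (p : α) (n : ℕ) :
    ∃ (ι : Type) (_ : Finite ι) (_ : Nonempty ι) (ψ : ι → MF α),
      2 ^ Nat.card ι = tower (n + 1) 2 ∧ IsSeparating (boxIter n (.var p)) ψ := by
  induction n with
  | zero => exact ⟨Unit, inferInstance, inferInstance, _, by simp [tower], isSeparating_var p⟩
  | succ n ih =>
    obtain ⟨ι, _, _, ψ, hcard, hψ⟩ := ih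
    have := Fintype.ofFinite ι
    obtain ⟨ψ', hψ'⟩ := hψ.box (posForm_boxIter (.var p) n)
    refine ⟨Set ι, inferInstance, inferInstance, ψ', ?_, hψ'⟩
    rw [Nat.card_eq_fintype_card, Fintype.card_set, ← Nat.card_eq_fintype_card, hcard, tower]

/-- A separating family bounds the number of positive examples from below. -/
theorem IsSeparating.card_le_ncard {α ι : Type} {χ : MF α} {ψ : ι → MF α}
    (h : IsSeparating χ ψ) {Ep En : Set (PModel α)}
    (hE : FinCharOf {φ : MF α | PosForm φ} χ Ep En) : Nat.card ι ≤ Ep.ncard := by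
  obtain ⟨hEp, -, -, -, hpos, hneg, huniq⟩ := hE
  have hex : ∀ i, ∃ M ∈ Ep, ¬ PSat M (ψ i) := by
    intro i
    by_contra! hi
    obtain ⟨M, hM, hM'⟩ := h.exists_not i
    exact hM' ((huniq (ψ i) (h.posForm i) hi (fun N hN hN' => hneg N hN (h.sat i N _ hN')) M).2 hM)
  choose f hf hf' using hex
  have : Finite Ep := hEp
  refine Nat.card_le_card_of_injective (fun i => (⟨f i, hf i⟩ : Ep)) fun i j hij => ?_
  have hij' : f i = f j := congrArg Subtype.val hij
  exact h.unique i j (f i) _ (hpos _ (hf i)) (hf' i) (hij' ▸ hf' j)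

/-- The dual of a modal formula, without negating the variables. -/
def MF.dual {α : Type} : MF α → MF α
  | .top => .bot
  | .bot => .top
  | .var p => .var p
  | .nvar p => .nvar p
  | .and φ ψ => .or φ.dual ψ.dual
  | .or φ ψ => .and φ.dual ψ.dual
  | .dia φ => .box φ.dual
  | .box φ => .dia φ.dual

/-- The pointed model with complemented colouring. -/
def PModel.flip {α : Type} (M : PModel α) : PModel α := { M with val := fun w => (M.val w)ᶜ }

theorem PModel.flip_flip {α : Type} (M : PModel α) : M.flip.flip = M := by
  simp [PModel.flip]

theorem sat_flip_dual {α : Type} (M : PModel α) (φ : MF α) :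
    ∀ w : M.World, Sat M.flip w φ.dual ↔ ¬ Sat M w φ := by
  induction φ with
  | top | bot | var | nvar => simp [MF.dual, Sat, PModel.flip]
  | and φ ψ ihφ ihψ => intro w; simp only [MF.dual, Sat, ihφ, ihψ]; tauto
  | or φ ψ ihφ ihψ => intro w; simp only [MF.dual, Sat, ihφ, ihψ]; tauto
  | dia φ ih =>
    intro w
    simp only [MF.dual, Sat, not_exists, not_and]
    exact forall_congr' fun u => imp_congr_right fun _ => ih u
  | box φ ih =>
    intro w
    simp only [MF.dual, Sat, not_forall, exists_prop]
    exact exists_congr fun u => and_congr_right fun _ => ih u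

theorem pSat_flip_dual {α : Type} (M : PModel α) (φ : MF α) :
    PSat M.flip φ.dual ↔ ¬ PSat M φ :=
  sat_flip_dual M φ M.pt

theorem pSat_dual {α : Type} (M : PModel α) (φ : MF α) :
    PSat M φ.dual ↔ ¬ PSat M.flip φ := by
  rw [← pSat_flip_dual, PModel.flip_flip]

theorem PosForm.dual {α : Type} {φ : MF α} (h : PosForm φ) : PosForm φ.dual := by
  induction h with
  | var p => exact .var p
  | and _ _ ihφ ihψ => exact .or ihφ ihψ
  | or _ _ ihφ ihψ => exact .and ihφ ihψ
  | dia _ ih => exact .box ih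
  | box _ ih => exact .dia ih

theorem dual_diaIter {α : Type} (p : α) (n : ℕ) :
    (diaIter n (.var p)).dual = boxIter n (.var p) := by
  induction n with
  | zero => rfl
  | succ n ih => exact congrArg MF.box ih

/-- Dualising a finite characterisation exchanges positive and negative examples. -/
theorem FinCharOf.dual {α : Type} {φ : MF α} {Ep En : Set (PModel α)}
    (h : FinCharOf {ψ : MF α | PosForm ψ} φ Ep En) :
    FinCharOf {ψ : MF α | PosForm ψ} φ.dual (PModel.flip '' En) (PModel.flip '' Ep) := by
  obtain ⟨hEp, hEn, hEp', hEn', hpos, hneg, huniq⟩ := h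
  refine ⟨hEn.image _, hEp.image _, ?_, ?_, ?_, ?_, fun ψ hψ hp hn M => ?_⟩
  · rintro _ ⟨M, hM, rfl⟩
    exact hEn' M hM
  · rintro _ ⟨M, hM, rfl⟩
    exact hEp' M hM
  · rintro _ ⟨M, hM, rfl⟩
    exact (pSat_flip_dual M φ).2 (hneg M hM)
  · rintro _ ⟨M, hM, rfl⟩
    rw [pSat_flip_dual, not_not]
    exact hpos M hM
  · have := huniq ψ.dual (PosForm.dual hψ)
      (fun M hM => (pSat_dual M ψ).2 (hn _ ⟨M, hM, rfl⟩))
      (fun M hM => by rw [pSat_dual, not_not]; exact hp _ ⟨M, hM, rfl⟩) M.flip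
    rw [pSat_dual, M.flip_flip] at this
    rw [pSat_dual]
    tauto

/-- over Prop = {p} (here `α = Unit`), every finite characterisation
of `□ⁿp` with respect to L_{□,◇,∧,∨}[{p}] has at least `tower n 2` positive
examples, and every finite characterisation of `◇ⁿp` has at least `tower n 2`
negative examples. -/
theorem finChar_tower_lower_bound (n : ℕ) (hn : 1 ≤ n) :
    (∀ Ep En : Set (PModel Unit),
        FinCharOf {ψ : MF Unit | PosForm ψ} (boxIter n (MF.var ())) Ep En →
        tower n 2 ≤ Ep.ncard) ∧
    (∀ Ep En : Set (PModel Unit),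
        FinCharOf {ψ : MF Unit | PosForm ψ} (diaIter n (MF.var ())) Ep En →
        tower n 2 ≤ En.ncard) := by
  obtain ⟨m, rfl⟩ : ∃ m, n = m + 1 := ⟨n - 1, by omega⟩
  obtain ⟨ι, _, _, ψ, hcard, hψ⟩ := exists_isSeparating_boxIter () (m + 1)
  have hcard' : Nat.card ι = tower (m + 1) 2 := Nat.pow_right_injective le_rfl hcard
  refine ⟨fun Ep En hE => hcard' ▸ hψ.card_le_ncard hE, fun Ep En hE => ?_⟩
  have hE' := hE.dual
  rw [dual_diaIter] at hE'
  rw [← hcard', ← Set.ncard_image_of_injective En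
    (Function.LeftInverse.injective PModel.flip_flip)]
  exact hψ.card_le_ncard hE'
end

section
/- For all disjoint finite sets P and Q of propositional variables, the uniform fragment L_{□,◇,∧,∨,¬at}[P;Q] admits finite characterisations: every formula built with ∧, ∨, ◇, □ from unnegated variables p ∈ P and negated variables ¬q with q ∈ Q has a finite characterisation (E⁺,E⁻) consisting of finite pointed models such that every ψ in the fragment true at all members of E⁺ and false at all members of E⁻ is equivalent to φ. -/
/-- The uniform fragment L_{□,◇,∧,∨,¬at}[P;Q]: formulas built using only ∧, ∨, ◇, □
from unnegated variables in `P` and negated variables in `Q`. -/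
inductive UniForm {α : Type} (P Q : Set α) : MF α → Prop
  | var {p : α} : p ∈ P → UniForm P Q (MF.var p)
  | nvar {q : α} : q ∈ Q → UniForm P Q (MF.nvar q)
  | and {φ ψ : MF α} : UniForm P Q φ → UniForm P Q ψ → UniForm P Q (MF.and φ ψ)
  | or {φ ψ : MF α} : UniForm P Q φ → UniForm P Q ψ → UniForm P Q (MF.or φ ψ)
  | dia {φ : MF α} : UniForm P Q φ → UniForm P Q (MF.dia φ)
  | box {φ : MF α} : UniForm P Q φ → UniForm P Q (MF.box φ)

/-- Modal depth. -/
def MF.depth {α : Type} : MF α → ℕ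
  | top => 0
  | bot => 0
  | var _ => 0
  | nvar _ => 0
  | and φ ψ => max φ.depth ψ.depth
  | or φ ψ => max φ.depth ψ.depth
  | dia φ => φ.depth + 1
  | box φ => φ.depth + 1

namespace PModel

variable {α : Type}

/-- The same Kripke model with another distinguished point. -/
def withPt (M : PModel α) (w : M.World) : PModel α := { M with pt := w }

theorem sat_withPt (M : PModel α) (x w : M.World) (φ : MF α) :
    Sat (M.withPt x) w φ ↔ Sat M w φ := by
  induction φ generalizing w with
  | top | bot | var | nvar => exact Iff.rfl
  | and φ ψ ih₁ ih₂ => exact and_congr (ih₁ w) (ih₂ w)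
  | or φ ψ ih₁ ih₂ => exact or_congr (ih₁ w) (ih₂ w)
  | dia φ ih => exact exists_congr fun u => and_congr Iff.rfl (ih u)
  | box φ ih => exact forall_congr' fun u => imp_congr Iff.rfl (ih u)

theorem pSat_withPt (M : PModel α) (w : M.World) (φ : MF α) :
    PSat (M.withPt w) φ ↔ Sat M w φ :=
  sat_withPt M w w φ

/-- A single reflexive world with valuation `c`. -/
def loop (c : Set α) : PModel α where
  World := Unit
  Rel _ _ := True
  val _ := c
  pt := ()

/-- Add to `M` a world for each choice of a valuation and a set of successors in `M`. -/
def extend (M : PModel α) : PModel α where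
  World := M.World ⊕ (Set α × Set M.World)
  Rel
    | .inl w, .inl u => M.Rel w u
    | .inr x, .inl u => u ∈ x.2
    | _, .inr _ => False
  val
    | .inl w => M.val w
    | .inr x => x.1
  pt := .inl M.pt

/-- The model of all trees of depth `n` over a reflexive world with valuation `c`. -/
def universal (c : Set α) : ℕ → PModel α
  | 0 => loop c
  | n + 1 => (universal c n).extend

theorem finite_universal [Finite α] (c : Set α) (n : ℕ) :
    Finite (universal c n).World := by
  induction n with
  | zero => exact inferInstanceAs (Finite Unit)
  | succ n ih =>
    exact inferInstanceAs
      (Finite ((universal c n).World ⊕ (Set α × Set (universal c n).World)))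

theorem sat_extend_inl (M : PModel α) (w : M.World) (φ : MF α) :
    Sat M.extend (.inl w) φ ↔ Sat M w φ := by
  induction φ generalizing w with
  | top | bot | var | nvar => exact Iff.rfl
  | and φ ψ ih₁ ih₂ => exact and_congr (ih₁ w) (ih₂ w)
  | or φ ψ ih₁ ih₂ => exact or_congr (ih₁ w) (ih₂ w)
  | dia φ ih =>
    constructor
    · rintro ⟨u | u, hu, h⟩
      · exact ⟨u, hu, (ih u).1 h⟩
      · exact hu.elim
    · rintro ⟨u, hu, h⟩
      exact ⟨.inl u, hu, (ih u).2 h⟩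
  | box φ ih =>
    constructor
    · exact fun h u hu => (ih u).1 (h (.inl u) hu)
    · rintro h (u | u) hu
      · exact (ih u).2 (h u hu)
      · exact hu.elim

/-- The unravelling of `M` at `w`, cut off at depth `n`. -/
def trunc (c : Set α) (M : PModel α) : (n : ℕ) → M.World → (universal c n).World
  | 0, _ => ()
  | n + 1, w => .inr (M.val w, trunc c M n '' {u | M.Rel w u})

variable {c : Set α} {M : PModel α} {n : ℕ} {w : M.World} {φ : MF α}

theorem sat_trunc_succ_dia :
    Sat (universal c (n + 1)) (trunc c M (n + 1) w) (.dia φ) ↔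
      ∃ u, M.Rel w u ∧ Sat (universal c n) (trunc c M n u) φ := by
  constructor
  · rintro ⟨x | x, hx, h⟩
    · obtain ⟨u, hu, rfl⟩ := hx
      exact ⟨u, hu, (sat_extend_inl _ _ _).1 h⟩
    · exact hx.elim
  · rintro ⟨u, hu, h⟩
    exact ⟨.inl (trunc c M n u), ⟨u, hu, rfl⟩, (sat_extend_inl _ _ _).2 h⟩

theorem sat_trunc_succ_box :
    Sat (universal c (n + 1)) (trunc c M (n + 1) w) (.box φ) ↔
      ∀ u, M.Rel w u → Sat (universal c n) (trunc c M n u) φ := by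
  constructor
  · intro h u hu
    exact (sat_extend_inl _ _ _).1 (h (.inl (trunc c M n u)) ⟨u, hu, rfl⟩)
  · rintro h (x | x) hx
    · obtain ⟨u, hu, rfl⟩ := hx
      exact (sat_extend_inl _ _ _).2 (h u hu)
    · exact hx.elim

theorem sat_trunc_iff (h : φ.depth < n) :
    Sat (universal c n) (trunc c M n w) φ ↔ Sat M w φ := by
  induction φ generalizing n w with
  | top | bot => exact Iff.rfl
  | var p | nvar p =>
    obtain ⟨n, rfl⟩ := Nat.exists_eq_succ_of_ne_zero h.ne_bot
    exact Iff.rfl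
  | and φ ψ ih₁ ih₂ =>
    exact and_congr (ih₁ (lt_of_le_of_lt (le_max_left _ _) h))
      (ih₂ (lt_of_le_of_lt (le_max_right _ _) h))
  | or φ ψ ih₁ ih₂ =>
    exact or_congr (ih₁ (lt_of_le_of_lt (le_max_left _ _) h))
      (ih₂ (lt_of_le_of_lt (le_max_right _ _) h))
  | dia φ ih =>
    obtain ⟨n, rfl⟩ := Nat.exists_eq_succ_of_ne_zero (Nat.ne_zero_of_lt h)
    exact sat_trunc_succ_dia.trans
      (exists_congr fun u => and_congr Iff.rfl (ih (Nat.lt_of_succ_lt_succ h)))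
  | box φ ih =>
    obtain ⟨n, rfl⟩ := Nat.exists_eq_succ_of_ne_zero (Nat.ne_zero_of_lt h)
    exact sat_trunc_succ_box.trans
      (forall_congr' fun u => imp_congr Iff.rfl (ih (Nat.lt_of_succ_lt_succ h)))

end PModel

namespace UniForm

open PModel

variable {α : Type} {P Q : Set α} {φ : MF α}

/-- The reflexive world at which exactly `Q` is true falsifies the whole fragment. -/
theorem not_sat_loop (hφ : UniForm P Q φ) (hdisj : Disjoint P Q) :
    ¬ Sat (loop Q) () φ := by
  induction hφ with
  | var hp => exact Set.disjoint_left.1 hdisj hp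
  | nvar hq => exact not_not_intro hq
  | and _ _ ih _ => exact fun h => ih h.1
  | or _ _ ih₁ ih₂ => exact fun h => h.elim ih₁ ih₂
  | dia _ ih => exact fun ⟨_, _, h⟩ => ih h
  | box _ ih => exact fun h => ih (h () trivial)

/-- The reflexive world at which exactly `P` is true satisfies the whole fragment. -/
theorem sat_loop (hφ : UniForm P Q φ) (hdisj : Disjoint P Q) :
    Sat (loop P) () φ := by
  induction hφ with
  | var hp => exact hp
  | nvar hq => exact Set.disjoint_right.1 hdisj hq
  | and _ _ ih₁ ih₂ => exact ⟨ih₁, ih₂⟩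
  | or _ _ ih _ => exact Or.inl ih
  | dia _ ih => exact ⟨(), trivial, ih⟩
  | box _ ih => exact fun _ _ => ih

theorem sat_of_sat_trunc (hφ : UniForm P Q φ) (hdisj : Disjoint P Q) {M : PModel α} {n : ℕ}
    {w : M.World} (h : Sat (universal Q n) (trunc Q M n w) φ) : Sat M w φ := by
  induction hφ generalizing n w with
  | and _ _ ih₁ ih₂ => exact ⟨ih₁ h.1, ih₂ h.2⟩
  | or _ _ ih₁ ih₂ => exact h.imp ih₁ ih₂
  | var hp =>
    cases n with
    | zero => exact (not_sat_loop (.var hp) hdisj h).elim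
    | succ n => exact h
  | nvar hq =>
    cases n with
    | zero => exact (not_sat_loop (.nvar hq) hdisj h).elim
    | succ n => exact h
  | dia hφ ih =>
    cases n with
    | zero => exact (not_sat_loop hφ.dia hdisj h).elim
    | succ n => exact (sat_trunc_succ_dia.1 h).imp fun u hu => ⟨hu.1, ih hu.2⟩
  | box hφ ih =>
    cases n with
    | zero => exact (not_sat_loop hφ.box hdisj h).elim
    | succ n => exact fun u hu => ih (sat_trunc_succ_box.1 h u hu)

theorem sat_trunc_of_sat (hφ : UniForm P Q φ) (hdisj : Disjoint P Q) {M : PModel α} {n : ℕ}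
    {w : M.World} (h : Sat M w φ) : Sat (universal P n) (trunc P M n w) φ := by
  induction hφ generalizing n w with
  | and _ _ ih₁ ih₂ => exact ⟨ih₁ h.1, ih₂ h.2⟩
  | or _ _ ih₁ ih₂ => exact h.imp ih₁ ih₂
  | var hp =>
    cases n with
    | zero => exact sat_loop (.var hp) hdisj
    | succ n => exact h
  | nvar hq =>
    cases n with
    | zero => exact sat_loop (.nvar hq) hdisj
    | succ n => exact h
  | dia hφ ih =>
    cases n with
    | zero => exact sat_loop hφ.dia hdisj
    | succ n => exact sat_trunc_succ_dia.2 (h.imp fun u hu => ⟨hu.1, ih hu.2⟩)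
  | box hφ ih =>
    cases n with
    | zero => exact sat_loop hφ.box hdisj
    | succ n => exact sat_trunc_succ_box.2 fun u hu => ih (h u hu)

end UniForm

/-- for all disjoint finite sets `P`, `Q` of propositional variables,
the uniform fragment L_{□,◇,∧,∨,¬at}[P;Q] admits finite characterisations. -/
theorem uniform_admits_finChar {α : Type} [Fintype α] (P Q : Set α)
    (hdisj : Disjoint P Q) (φ : MF α) (hφ : UniForm P Q φ) :
    ∃ Ep En : Set (PModel α), FinCharOf {ψ : MF α | UniForm P Q ψ} φ Ep En := by
  classical
  let n := φ.depth + 1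
  have hn : φ.depth < n := Nat.lt_succ_self _
  have := PModel.finite_universal P n
  have := PModel.finite_universal Q n
  let E : Set (PModel α) :=
    Set.range (PModel.universal P n).withPt ∪ Set.range (PModel.universal Q n).withPt
  have hE : E.Finite := (Set.finite_range _).union (Set.finite_range _)
  have hfin : ∀ M ∈ E, Finite M.World := by
    rintro _ (⟨w, rfl⟩ | ⟨w, rfl⟩) <;> assumption
  refine ⟨{M ∈ E | PSat M φ}, {M ∈ E | ¬ PSat M φ}, hE.sep _, hE.sep _,
    fun M hM => hfin M hM.1, fun M hM => hfin M hM.1, fun M hM => hM.2, fun M hM => hM.2, ?_⟩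
  intro ψ hψ hpos hneg M
  have key : ∀ N ∈ E, (PSat N ψ ↔ PSat N φ) := fun N hN =>
    ⟨fun h => by_contra fun h' => hneg N ⟨hN, h'⟩ h, fun h => hpos N ⟨hN, h⟩⟩
  constructor
  · intro h
    have h' := UniForm.sat_trunc_of_sat hψ hdisj (n := n) h
    rw [← PModel.pSat_withPt, key _ (.inl ⟨_, rfl⟩), PModel.pSat_withPt] at h'
    exact (PModel.sat_trunc_iff hn).1 h'
  · intro h
    have h' := (PModel.sat_trunc_iff (c := Q) hn).2 h
    rw [← PModel.pSat_withPt, ← key _ (.inr ⟨_, rfl⟩), PModel.pSat_withPt] at h'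
    exact UniForm.sat_of_sat_trunc hψ hdisj h'
end
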